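/- Let n be an odd positive integer and m an odd integer with 0 < m < n/3. Then the trinomial x^n + x^m + 1 ∈ F_2[x] is squarefree, and it has an odd number of irreducible factors if n ≡ ±1 (mod 8), and an even number of irreducible factors if n ≡ ±3 (mod 8). -/

import Mathlib

open Polynomial

theorem aeval_esymm_eq_coeff {R : Type*} [CommRing R] {n : ℕ} {F : ℤ[X]} {α : Fin n → R}
    (hα : ∏ i, (X - C (α i)) = F.map (Int.castRingHom R)) {k : ℕ} (hk : k ≤ n) :
    MvPolynomial.aeval α (MvPolynomial.esymm (Fin n) ℤ k) = (-1) ^ k * (F.coeff (n - k) : R) := by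
  have h := Multiset.prod_X_sub_C_coeff (Finset.univ.val.map α) (k := n - k) (by simp)
  have h2 : n - (n - k) = k := by omega
  rw [Multiset.map_map] at h
  simp only [Multiset.card_map, Finset.card_val, Finset.card_univ, Fintype.card_fin, h2] at h
  change (∏ i, (X - C (α i))).coeff (n - k) = _ at h
  rw [hα, coeff_map, eq_intCast] at h
  rw [MvPolynomial.aeval_esymm_eq_multiset_esymm, h, ← mul_assoc, ← mul_pow]
  simp

/-- The value of a symmetric integer polynomial at the roots of `F`. -/
theorem exists_int_aeval_eq_of_isSymmetric {n : ℕ} {P : MvPolynomial (Fin n) ℤ}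
    (hP : P.IsSymmetric) (F : ℤ[X]) :
    ∃ z : ℤ, ∀ (R : Type) [CommRing R] (α : Fin n → R),
      ∏ i, (X - C (α i)) = F.map (Int.castRingHom R) → MvPolynomial.aeval α P = (z : R) := by
  obtain ⟨Q, hQ⟩ := MvPolynomial.esymmAlgHom_surjective (σ := Fin n) ℤ
    (Fintype.card_fin n).le ⟨P, hP⟩
  refine ⟨MvPolynomial.aeval (fun i : Fin n ↦ (-1) ^ ((i : ℕ) + 1) * F.coeff (n - (i + 1))) Q,
    fun R _ α hα ↦ ?_⟩
  have hP' : P = MvPolynomial.aeval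
      (fun i : Fin n ↦ MvPolynomial.esymm (Fin n) ℤ ((i : ℕ) + 1)) Q := by
    rw [← MvPolynomial.esymmAlgHom_apply, hQ]
  rw [hP', ← AlgHom.comp_apply, MvPolynomial.comp_aeval, ← eq_intCast (algebraMap ℤ R),
    ← MvPolynomial.aeval_algebraMap_apply]
  congr 2
  ext i
  rw [aeval_esymm_eq_coeff hα (by omega)]
  simp

section VandermondePart

variable {R S : Type*} [CommRing R] [CommRing S] {n : ℕ}

/-- The part of the Leibniz expansion of the Vandermonde determinant, taken without signs, that is
indexed by the permutations of sign `s`. -/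
def vandermondePart (s : ℤˣ) (x : Fin n → R) : R :=
  ∑ τ : Equiv.Perm (Fin n) with Equiv.Perm.sign τ = s, ∏ i, x (τ i) ^ (i : ℕ)

theorem det_vandermonde_eq_vandermondePart_sub (x : Fin n → R) :
    (Matrix.vandermonde x).det = vandermondePart 1 x - vandermondePart (-1) x := by
  have h : ∀ τ : Equiv.Perm (Fin n), ¬ Equiv.Perm.sign τ = 1 ↔ Equiv.Perm.sign τ = -1 :=
    fun τ ↦ by rcases Int.units_eq_one_or (Equiv.Perm.sign τ) with h | h <;> rw [h] <;> decide
  rw [Matrix.det_apply, ← Finset.sum_filter_add_sum_filter_not _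
    (fun τ : Equiv.Perm (Fin n) ↦ Equiv.Perm.sign τ = 1), vandermondePart, vandermondePart,
    sub_eq_add_neg, ← Finset.sum_neg_distrib]
  simp only [h]
  congr 1 <;> refine Finset.sum_congr rfl fun τ hτ ↦ ?_ <;>
    simp [(Finset.mem_filter.mp hτ).2, Matrix.vandermonde_apply]

theorem vandermondePart_comp (s : ℤˣ) (x : Fin n → R) (σ : Equiv.Perm (Fin n)) :
    vandermondePart s (x ∘ σ) = vandermondePart (Equiv.Perm.sign σ * s) x := by
  refine Finset.sum_equiv (Equiv.mulLeft σ) (fun τ ↦ ?_) (fun τ _ ↦ ?_)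
  · simp
  · simp

theorem map_vandermondePart (φ : R →+* S) (s : ℤˣ) (x : Fin n → R) :
    φ (vandermondePart s x) = vandermondePart s (φ ∘ x) := by
  simp [vandermondePart]

theorem vandermondePart_comp_cases (x : Fin n → R) (σ : Equiv.Perm (Fin n)) :
    (vandermondePart 1 (x ∘ σ) = vandermondePart 1 x ∧
      vandermondePart (-1) (x ∘ σ) = vandermondePart (-1) x) ∨
    (vandermondePart 1 (x ∘ σ) = vandermondePart (-1) x ∧
      vandermondePart (-1) (x ∘ σ) = vandermondePart 1 x) := by
  rcases Int.units_eq_one_or (Equiv.Perm.sign σ) with h | h <;> simp [vandermondePart_comp, h]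

theorem rename_vandermondePart (s : ℤˣ) (σ : Equiv.Perm (Fin n)) :
    MvPolynomial.rename σ (vandermondePart s (MvPolynomial.X : Fin n → MvPolynomial (Fin n) ℤ)) =
      vandermondePart s (MvPolynomial.X ∘ σ) := by
  rw [← AlgHom.coe_toRingHom, map_vandermondePart]
  congr 1
  ext i
  simp

theorem aeval_vandermondePart (s : ℤˣ) (x : Fin n → R) :
    MvPolynomial.aeval x (vandermondePart s (MvPolynomial.X : Fin n → MvPolynomial (Fin n) ℤ)) =
      vandermondePart s x := by
  rw [← AlgHom.coe_toRingHom, map_vandermondePart]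
  congr 1
  ext i
  simp

end VandermondePart

/-- A form of Stickelberger's theorem at the prime `2`: the discriminant modulo `8` determines the
sign of the Frobenius permutation of the roots in characteristic `2`. -/
theorem exists_int_eq_det_vandermonde_sq {K : Type} [Field K] [CharP K 2] {n : ℕ} {F : ℤ[X]}
    {β : Fin n → K} (hβ : ∏ i, (X - C (β i)) = F.map (Int.castRingHom K))
    (hinj : Function.Injective β) {σ : Equiv.Perm (Fin n)} (hσ : ∀ i, β (σ i) = β i ^ 2) :
    ∃ d : ℤ, (∀ (R : Type) [CommRing R] (α : Fin n → R),
        ∏ i, (X - C (α i)) = F.map (Int.castRingHom R) →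
          (Matrix.vandermonde α).det ^ 2 = (d : R)) ∧
      (Equiv.Perm.sign σ = 1 → d % 8 = 1) ∧ (Equiv.Perm.sign σ = -1 → d % 8 = 5) := by
  have hadd : (vandermondePart 1 MvPolynomial.X + vandermondePart (-1) MvPolynomial.X :
      MvPolynomial (Fin n) ℤ).IsSymmetric := fun τ ↦ by
    rw [map_add, rename_vandermondePart, rename_vandermondePart]
    rcases vandermondePart_comp_cases (MvPolynomial.X : Fin n → MvPolynomial (Fin n) ℤ) τ with
      h | h <;> rw [h.1, h.2]
    ring
  have hmul : (vandermondePart 1 MvPolynomial.X * vandermondePart (-1) MvPolynomial.X :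
      MvPolynomial (Fin n) ℤ).IsSymmetric := fun τ ↦ by
    rw [map_mul, rename_vandermondePart, rename_vandermondePart]
    rcases vandermondePart_comp_cases (MvPolynomial.X : Fin n → MvPolynomial (Fin n) ℤ) τ with
      h | h <;> rw [h.1, h.2]
    ring
  obtain ⟨u, hu⟩ := exists_int_aeval_eq_of_isSymmetric hadd F
  obtain ⟨w, hw⟩ := exists_int_aeval_eq_of_isSymmetric hmul F
  simp only [map_add, map_mul, aeval_vandermondePart] at hu hw
  have hdet := Matrix.det_vandermonde_ne_zero_iff.mpr hinj
  rw [det_vandermonde_eq_vandermondePart_sub, CharTwo.sub_eq_add, hu K β hβ] at hdet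
  have hfrob : vandermondePart 1 β ^ 2 = vandermondePart (Equiv.Perm.sign σ) β := by
    rw [← frobenius_def, map_vandermondePart, ← mul_one (Equiv.Perm.sign σ),
      ← vandermondePart_comp]
    congr 1
    ext i
    simp [hσ, frobenius_def]
  have hcast : ∀ z : ℤ, (z : K) = 0 ↔ z % 2 = 0 := fun z ↦ by
    rw [CharP.intCast_eq_zero_iff K 2]
    omega
  have hu2 : u % 2 = 1 := by
    have := (hcast u).not.mp hdet
    omega
  have huK : (u : K) = 1 := by
    rw [← sub_eq_zero, ← Int.cast_one, ← Int.cast_sub, hcast]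
    omega
  have hAB := hu K β hβ
  have hw' := hw K β hβ
  rw [huK] at hAB
  have husq : u ^ 2 % 8 = 1 := by
    rcases (by omega : u % 8 = 1 ∨ u % 8 = 3 ∨ u % 8 = 5 ∨ u % 8 = 7) with h | h | h | h <;>
      simp [pow_two, Int.mul_emod, h]
  refine ⟨u ^ 2 - 4 * w, fun R _ α hα ↦ ?_, fun hs ↦ ?_, fun hs ↦ ?_⟩
  · rw [det_vandermonde_eq_vandermondePart_sub]
    push_cast
    rw [← hu R α hα, ← hw R α hα]
    ring
  · rw [hs] at hfrob
    have : w % 2 = 0 := by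
      rw [← hcast, ← hw']
      linear_combination vandermondePart 1 β * hAB - hfrob
    omega
  · rw [hs] at hfrob
    have h1 : w % 2 ≠ 0 := by
      rw [ne_eq, ← hcast, ← hw']
      intro h
      rcases mul_eq_zero.mp h with h0 | h0
      · rw [← hfrob, h0] at hAB
        norm_num at hAB
      · rw [h0] at hfrob hAB
        rw [pow_eq_zero_iff two_ne_zero] at hfrob
        rw [hfrob] at hAB
        norm_num at hAB
    omega

theorem Polynomial.Monic.eq_prod_X_sub_C_of_injective {L : Type*} [Field L] {g : L[X]}
    (hg : g.Monic) {n : ℕ} (hn : g.natDegree = n) {x : Fin n → L} (hx : Function.Injective x)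
    (hroot : ∀ i, g.IsRoot (x i)) : ∏ i, (X - C (x i)) = g := by
  have hdvd : ∏ i, (X - C (x i)) ∣ g :=
    Finset.prod_dvd_of_coprime (fun i _ j _ hij ↦ pairwise_coprime_X_sub_C hx hij)
      fun i _ ↦ dvd_iff_isRoot.mpr (hroot i)
  exact (eq_of_monic_of_dvd_of_natDegree_le (monic_prod_X_sub_C _ _) hg hdvd (by simp [hn])).symm

theorem Irreducible.exists_prod_X_sub_C_frobenius {K : Type*} [Field K] [Algebra (ZMod 2) K]
    [IsAlgClosed K] {g : (ZMod 2)[X]} (hg : Irreducible g) (hm : g.Monic) :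
    ∃ β : Fin g.natDegree → K, ∏ i, (X - C (β i)) = g.map (algebraMap (ZMod 2) K) ∧
      ∀ i, β (finRotate _ i) = β i ^ 2 := by
  have : Fact (Irreducible g) := ⟨hg⟩
  let pb := AdjoinRoot.powerBasis hg.ne_zero
  have : Module.Finite (ZMod 2) (AdjoinRoot g) := pb.finite
  have : Finite (AdjoinRoot g) := Module.finite_of_finite (ZMod 2)
  have : Fintype (AdjoinRoot g) := Fintype.ofFinite _
  have hrank : Module.finrank (ZMod 2) (AdjoinRoot g) = g.natDegree := by
    rw [pb.finrank, AdjoinRoot.powerBasis_dim]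
  have hcard : AdjoinRoot.root g ^ 2 ^ g.natDegree = AdjoinRoot.root g := by
    conv_rhs => rw [← FiniteField.pow_card (AdjoinRoot.root g)]
    rw [Module.card_eq_pow_finrank (K := ZMod 2), hrank, ZMod.card]
  have hfrob : ∀ k : ℕ, (FiniteField.frobeniusAlgHom (ZMod 2) (AdjoinRoot g) ^ k)
      (AdjoinRoot.root g) = AdjoinRoot.root g ^ 2 ^ k := fun k ↦ by
    rw [AlgHom.coe_pow, FiniteField.coe_frobeniusAlgHom, pow_iterate, ZMod.card]
  have hinj : Function.Injective
      fun i : Fin g.natDegree ↦ AdjoinRoot.root g ^ 2 ^ (i : ℕ) := fun i j hij ↦ by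
    have h : FiniteField.frobeniusAlgHom (ZMod 2) (AdjoinRoot g) ^ (i : ℕ) =
        FiniteField.frobeniusAlgHom (ZMod 2) (AdjoinRoot g) ^ (j : ℕ) :=
      AdjoinRoot.algHom_ext (by rw [hfrob, hfrob]; exact hij)
    have := (FiniteField.bijective_frobeniusAlgHom_pow (ZMod 2) (AdjoinRoot g)).1
      (a₁ := Fin.cast hrank.symm i) (a₂ := Fin.cast hrank.symm j) h
    simpa using this
  have hprod := (hm.map (algebraMap (ZMod 2) (AdjoinRoot g))).eq_prod_X_sub_C_of_injective
    (natDegree_map _) hinj fun i ↦ by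
      rw [IsRoot.def, eval_map_algebraMap, ← hfrob, aeval_algHom_apply, AdjoinRoot.aeval_eq,
        AdjoinRoot.mk_self, map_zero]
  let φ : AdjoinRoot g →ₐ[ZMod 2] K := IsAlgClosed.lift
  refine ⟨fun i ↦ φ (AdjoinRoot.root g ^ 2 ^ (i : ℕ)), ?_, fun i ↦ ?_⟩
  · have := congrArg (Polynomial.map (φ : AdjoinRoot g →+* K)) hprod
    rw [Polynomial.map_map, AlgHom.comp_algebraMap] at this
    rw [← this, Polynomial.map_prod]
    simp
  · rw [← map_pow, ← pow_mul, ← pow_succ]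
    generalize hd : g.natDegree = d at *
    obtain _ | d := d
    · exact i.elim0
    refine congrArg φ ?_
    rw [coe_finRotate]
    split_ifs with h
    · rw [h, Fin.val_last, hcard, pow_zero, pow_one]
    · rfl

/-- The roots of a polynomial over `ZMod 2`, with the cycles of the Frobenius permutation
corresponding to the irreducible factors. -/
theorem exists_frobenius_perm (K : Type*) [Field K] [Algebra (ZMod 2) K] [IsAlgClosed K]
    (s : Multiset (ZMod 2)[X]) (hs : ∀ g ∈ s, Irreducible g) :
    ∃ (n : ℕ) (β : Fin n → K) (σ : Equiv.Perm (Fin n)),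
      ∏ i, (X - C (β i)) = s.prod.map (algebraMap (ZMod 2) K) ∧ (∀ i, β (σ i) = β i ^ 2) ∧
        Equiv.Perm.sign σ = (-1) ^ (n + s.card) := by
  induction s using Multiset.induction with
  | empty => exact ⟨0, Fin.elim0, 1, by simp, fun i ↦ i.elim0, by simp⟩
  | cons g s ih =>
    obtain ⟨n, β, σ, hprod, hσ, hsign⟩ := ih fun g' hg' ↦ hs g' (Multiset.mem_cons_of_mem hg')
    have hg := hs g (Multiset.mem_cons_self g s)
    have hm : g.Monic := by
      have h : ∀ a : ZMod 2, a ≠ 0 → a = 1 := by decide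
      exact h _ (leadingCoeff_ne_zero.mpr hg.ne_zero)
    obtain ⟨γ, hγ, hγσ⟩ := hg.exists_prod_X_sub_C_frobenius (K := K) hm
    refine ⟨g.natDegree + n, Sum.elim γ β ∘ finSumFinEquiv.symm,
      finSumFinEquiv.permCongr (Equiv.sumCongr (finRotate _) σ), ?_, fun i ↦ ?_, ?_⟩
    · rw [Multiset.prod_cons, Polynomial.map_mul, ← hγ, ← hprod, Fin.prod_univ_add]
      simp
    · obtain ⟨i, rfl⟩ := finSumFinEquiv.surjective i
      rcases i with i | i
      · simpa [Equiv.permCongr_apply] using hγσ i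
      · simpa [Equiv.permCongr_apply] using hσ i
    · obtain ⟨d, hd⟩ : ∃ d, g.natDegree = d + 1 := ⟨_, (Nat.succ_pred hg.natDegree_pos.ne').symm⟩
      rw [Equiv.Perm.sign_permCongr, Equiv.Perm.sign_sumCongr, sign_finRotate, hsign,
        Multiset.card_cons, hd, Nat.add_sub_cancel, ← pow_add,
        show d + 1 + n + (s.card + 1) = d + (n + s.card) + 2 by ring, pow_add _ _ 2]
      simp

theorem IsAlgClosed.exists_prod_X_sub_C_eq {K : Type*} [Field K] [IsAlgClosed K] {f : K[X]}
    (hf : f.Monic) {n : ℕ} (hn : f.natDegree = n) :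
    ∃ α : Fin n → K, ∏ i, (X - C (α i)) = f := by
  subst hn
  have hsplit := IsAlgClosed.splits f
  have hlen : f.roots.toList.length = f.natDegree := by
    rw [Multiset.length_toList, splits_iff_card_roots.mp hsplit]
  refine ⟨fun i ↦ f.roots.toList.get (Fin.cast hlen.symm i), ?_⟩
  conv_rhs => rw [hsplit.eq_prod_roots_of_monic hf, ← Multiset.coe_toList f.roots,
    Multiset.map_coe, Multiset.prod_coe]
  rw [← List.prod_ofFn, List.ofFn_congr hlen.symm]
  congr 1
  conv_rhs => rw [← List.ofFn_get f.roots.toList, List.map_ofFn]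
  rfl

theorem det_vandermonde_sq_eq_prod_eval_derivative {R : Type*} [CommRing R] {n : ℕ}
    (α : Fin n → R) :
    (Matrix.vandermonde α).det ^ 2 = (-1) ^ (n * (n - 1) / 2) *
      ∏ i, (derivative (∏ j, (X - C (α j)))).eval (α i) := by
  have hderiv : ∀ i, (derivative (∏ j, (X - C (α j)))).eval (α i) =
      ∏ j ∈ {i}ᶜ, (α i - α j) := fun i ↦ by
    rw [derivative_prod_finset, eval_finsetSum, Finset.sum_eq_single i]
    · simp [eval_prod, Finset.compl_singleton]
    · intro j _ hj
      rw [eval_mul, eval_prod, Finset.prod_eq_zero (i := i)] <;> simp [hj.symm]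
    · simp
  have hcard : ∑ i : Fin n, (Finset.Ioi i).card = n * (n - 1) / 2 := by
    simp only [Fin.card_Ioi]
    rw [← Finset.sum_range_id, Finset.sum_range (fun i ↦ i),
      ← Equiv.sum_comp Fin.revPerm]
    refine Finset.sum_congr rfl fun i _ ↦ ?_
    simp [Fin.val_rev]
    omega
  simp_rw [hderiv]
  rw [← hcard, ← Finset.prod_pow_eq_pow_sum, Matrix.det_vandermonde]
  have h := Finset.prod_prod_Ioi_mul_eq_prod_prod_off_diag (fun i j : Fin n ↦ α j - α i)
  rw [← h, ← Finset.prod_pow, ← Finset.prod_mul_distrib]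
  refine Finset.prod_congr rfl fun i _ ↦ ?_
  rw [← Finset.prod_pow, ← Finset.prod_const, ← Finset.prod_mul_distrib]
  exact Finset.prod_congr rfl fun j _ ↦ by ring

theorem aeval_psum_eq_zero {R : Type*} [CommRing R] {n t : ℕ} {α : Fin n → R}
    (h : ∀ k, 0 < k → k < t → MvPolynomial.aeval α (MvPolynomial.esymm (Fin n) ℤ k) = 0)
    {k : ℕ} (hk : 0 < k) (hkt : k < t) :
    MvPolynomial.aeval α (MvPolynomial.psum (Fin n) ℤ k) = 0 := by
  rw [MvPolynomial.psum_eq_mul_esymm_sub_sum _ _ _ hk, map_sub, map_mul, h k hk hkt, map_sum,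
    Finset.sum_eq_zero]
  · simp
  · rintro a ha
    simp only [Finset.mem_filter, Set.mem_Ioo] at ha
    rw [map_mul, map_mul, h a.1 ha.2.1 (ha.2.2.trans hkt)]
    simp

theorem mul_aeval_esymm_eq_zero {R : Type*} [CommRing R] {n t : ℕ} {α : Fin n → R}
    (h : ∀ k, 0 < k → k < t → MvPolynomial.aeval α (MvPolynomial.psum (Fin n) ℤ k) = 0)
    {k : ℕ} (hkt : k < t) :
    k * MvPolynomial.aeval α (MvPolynomial.esymm (Fin n) ℤ k) = 0 := by
  rw [← map_natCast (MvPolynomial.aeval (R := ℤ) α), ← map_mul, MvPolynomial.mul_esymm_eq_sum, map_mul,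
    map_sum, Finset.sum_eq_zero, mul_zero]
  rintro a ha
  obtain ⟨ha, hak⟩ := Finset.mem_filter.mp ha
  have := Finset.HasAntidiagonal.mem_antidiagonal.mp ha
  rw [map_mul, h a.2 (by omega) (by omega), mul_zero]

theorem monic_map_trinomial {R : Type*} [CommRing R] {n m : ℕ} (hmn : m < n) :
    ((X ^ n + X ^ m + 1 : ℤ[X]).map (Int.castRingHom R)).Monic := by
  rw [add_assoc]
  refine (monic_X_pow_add ?_).map _
  refine (degree_add_le _ _).trans_lt (max_lt ?_ ?_)
  · rw [degree_X_pow]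
    exact_mod_cast hmn
  · rw [degree_one]
    exact_mod_cast Nat.zero_lt_of_lt hmn

theorem natDegree_map_trinomial {R : Type*} [CommRing R] [Nontrivial R] {n m : ℕ} (hmn : m < n) :
    ((X ^ n + X ^ m + 1 : ℤ[X]).map (Int.castRingHom R)).natDegree = n := by
  simp only [Polynomial.map_add, Polynomial.map_pow, map_X, Polynomial.map_one]
  compute_degree!
  · simp [show n ≠ m by omega, show n ≠ 0 by omega]
  · omega
  · omega

/-- The first two elementary symmetric functions of the `m`-th powers of the roots of
`X ^ n + X ^ m + 1` vanish, as the power sums of orders `m` and `2 * m` do. -/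
theorem exists_int_prod_add_mul_pow_eq {n m : ℕ} (hm : 0 < m) (hmn : 3 * m < n) {a b : ℤ}
    (hb : Even b) :
    ∃ w : ℤ, w ≡ a ^ n [ZMOD 8] ∧ ∀ α : Fin n → ℂ,
      ∏ i, (X - C (α i)) = (X ^ n + X ^ m + 1 : ℤ[X]).map (Int.castRingHom ℂ) →
        ∏ i, (a + b * α i ^ m) = (w : ℂ) := by
  set F : ℤ[X] := X ^ n + X ^ m + 1
  have hsymm : ∀ j, (MvPolynomial.aeval (fun i ↦ MvPolynomial.X i ^ m)
      (MvPolynomial.esymm (Fin n) ℤ j) : MvPolynomial (Fin n) ℤ).IsSymmetric := fun j τ ↦ by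
    conv_rhs => rw [← MvPolynomial.esymm_isSymmetric (Fin n) ℤ j τ]
    rw [MvPolynomial.aeval_rename, ← AlgHom.comp_apply, MvPolynomial.comp_aeval]
    congr 2
    ext i
    simp
  choose c hc using fun j ↦ exists_int_aeval_eq_of_isSymmetric (hsymm j) F
  have hc' : ∀ (j : ℕ) (α : Fin n → ℂ), ∏ i, (X - C (α i)) = F.map (Int.castRingHom ℂ) →
      MvPolynomial.aeval (fun i ↦ α i ^ m) (MvPolynomial.esymm (Fin n) ℤ j) = (c j : ℂ) :=
    fun j α hα ↦ by
      rw [← hc j ℂ α hα, ← AlgHom.comp_apply, MvPolynomial.comp_aeval]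
      simp
  have hsum : ∀ α : Fin n → ℂ, ∏ i, (X - C (α i)) = F.map (Int.castRingHom ℂ) →
      ∏ i, (a + b * α i ^ m) = ∑ j ∈ Finset.range (n + 1), (b ^ j * c j * a ^ (n - j) : ℂ) := by
    intro α hα
    have h := congrArg (Polynomial.eval (a : ℂ))
      (Multiset.prod_X_add_C_eq_sum_esymm (Finset.univ.val.map fun i ↦ (b : ℂ) * α i ^ m))
    simp only [Multiset.map_map, Multiset.card_map, Finset.card_val, Finset.card_univ,
      Fintype.card_fin, eval_finsetSum, eval_mul, eval_C, eval_pow, eval_X] at h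
    change eval (a : ℂ) (∏ i, (X + C ((b : ℂ) * α i ^ m))) = _ at h
    rw [eval_prod] at h
    simp only [eval_add, eval_X, eval_C] at h
    rw [h]
    refine Finset.sum_congr rfl fun j _ ↦ ?_
    rw [← hc' j α hα, MvPolynomial.aeval_esymm_eq_multiset_esymm, Finset.esymm_map_val,
      Finset.esymm_map_val, Finset.mul_sum]
    congr 1
    refine Finset.sum_congr rfl fun t ht ↦ ?_
    rw [Finset.prod_mul_distrib, Finset.prod_const, (Finset.mem_powersetCard.mp ht).2]
  refine ⟨∑ j ∈ Finset.range (n + 1), b ^ j * c j * a ^ (n - j), ?_, fun α hα ↦ ?_⟩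
  · obtain ⟨α, hα⟩ := IsAlgClosed.exists_prod_X_sub_C_eq (K := ℂ)
      (monic_map_trinomial (by omega : m < n)) (natDegree_map_trinomial (by omega))
    have hcoeff : ∀ k, 0 < k → k < n - m →
        MvPolynomial.aeval α (MvPolynomial.esymm (Fin n) ℤ k) = 0 := fun k hk hkn ↦ by
      rw [aeval_esymm_eq_coeff hα (by omega)]
      simp only [coeff_add, coeff_X_pow, coeff_one]
      simp [show n - k ≠ n by omega, show n - k ≠ m by omega, show n - k ≠ 0 by omega]
    have hpsum : ∀ k, 0 < k → k < 3 →
        MvPolynomial.aeval (fun i ↦ α i ^ m) (MvPolynomial.psum (Fin n) ℤ k) = 0 := by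
      intro k hk hk3
      have hmk : 0 < m * k ∧ m * k < n - m := by
        interval_cases k <;> omega
      rw [← aeval_psum_eq_zero hcoeff hmk.1 hmk.2]
      simp [MvPolynomial.psum, pow_mul]
    have hc0 : ∀ k, 0 < k → k < 3 → c k = 0 := fun k hk hk3 ↦ by
      have h := mul_aeval_esymm_eq_zero hpsum hk3
      rw [hc' k α hα] at h
      exact_mod_cast (mul_eq_zero.mp h).resolve_left (by exact_mod_cast hk.ne')
    have hdvd : (8 : ℤ) ∣ ∑ j ∈ Finset.range n, b ^ (j + 1) * c (j + 1) * a ^ (n - (j + 1)) := by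
      refine Finset.dvd_sum fun j _ ↦ Dvd.dvd.mul_right ?_ _
      rcases lt_or_ge (j + 1) 3 with hj | hj
      · simp [hc0 _ j.succ_pos hj]
      · have : (2 : ℤ) ^ 3 ∣ b ^ (j + 1) :=
          (pow_dvd_pow_of_dvd hb.two_dvd 3).trans (pow_dvd_pow b hj)
        exact this.mul_right _
    have hcz : c 0 = 1 := by
      have h := hc' 0 α hα
      rw [MvPolynomial.esymm_zero, map_one] at h
      exact_mod_cast h.symm
    rw [Finset.sum_range_succ', hcz]
    simpa using (Int.modEq_zero_iff_dvd.mpr hdvd).add_right (a ^ n)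
  · rw [hsum α hα]
    push_cast
    rfl

theorem det_vandermonde_sq_mod_eight {n m : ℕ} (hodd : Odd n) (hm : Odd m) (hmn : 3 * m < n)
    {d : ℤ} (hd : ∀ α : Fin n → ℂ,
      ∏ i, (X - C (α i)) = (X ^ n + X ^ m + 1 : ℤ[X]).map (Int.castRingHom ℂ) →
        (Matrix.vandermonde α).det ^ 2 = (d : ℂ)) :
    d % 8 = (-1) ^ (n * (n - 1) / 2) * n % 8 := by
  have hb : Even ((n : ℤ) - m) := by
    rw [Int.even_sub, Int.even_coe_nat, Int.even_coe_nat]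
    exact iff_of_false (Nat.not_even_iff_odd.mpr hodd) (Nat.not_even_iff_odd.mpr hm)
  obtain ⟨w, hw8, hw⟩ := exists_int_prod_add_mul_pow_eq hm.pos hmn (a := n) hb
  obtain ⟨α, hα⟩ := IsAlgClosed.exists_prod_X_sub_C_eq (K := ℂ)
    (monic_map_trinomial (by omega : m < n)) (natDegree_map_trinomial (by omega))
  have hprod : ∏ i, α i = -1 := by
    have h := congrArg (eval 0) hα
    simpa [eval_prod, Finset.prod_neg, hodd.neg_one_pow, hodd.pos.ne', hm.pos.ne',
      neg_eq_iff_eq_neg] using h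
  have hderiv : ∏ i, (derivative (∏ j, (X - C (α j)))).eval (α i) = w := by
    have hroot : ∀ i, α i * (derivative (∏ j, (X - C (α j)))).eval (α i) =
        -(((n : ℤ) : ℂ) + (((n : ℤ) - m : ℤ) : ℂ) * α i ^ m) := fun i ↦ by
      have h := congrArg (eval (α i)) hα
      rw [eval_prod, Finset.prod_eq_zero (Finset.mem_univ i) (by simp)] at h
      simp only [Polynomial.map_add, Polynomial.map_pow, map_X, Polynomial.map_one, eval_add,
        eval_pow, eval_X, eval_one] at h
      rw [hα]
      obtain ⟨p, rfl⟩ := hodd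
      obtain ⟨q, rfl⟩ := hm
      simp
      linear_combination (-(2 * p + 1) : ℂ) * h
    have h := Finset.prod_congr rfl fun i (_ : i ∈ Finset.univ) ↦ hroot i
    rw [Finset.prod_mul_distrib, hprod, Finset.prod_neg, hw α hα] at h
    simpa [hodd.neg_one_pow] using h
  have hdw : d = (-1) ^ (n * (n - 1) / 2) * w := by
    have h := hd α hα
    rw [det_vandermonde_sq_eq_prod_eval_derivative, hderiv] at h
    exact_mod_cast h.symm
  have hpow : (n : ℤ) ^ n ≡ n [ZMOD 8] := by
    obtain ⟨p, hp⟩ := hodd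
    have hsq : (n : ℤ) ^ 2 ≡ 1 [ZMOD 8] :=
      (Int.modEq_iff_dvd.mpr (Int.eight_dvd_sq_sub_one_of_odd
        (by exact_mod_cast (⟨p, hp⟩ : Odd n)))).symm
    have := (hsq.pow p).mul_right (n : ℤ)
    rwa [← pow_mul, ← pow_succ, ← hp, one_pow, one_mul] at this
  rw [hdw]
  exact (hw8.trans hpow).mul_left _

theorem neg_one_pow_mul_mod_eight {n : ℕ} (hodd : Odd n) :
    ((n % 8 = 1 ∨ n % 8 = 7) → (-1 : ℤ) ^ (n * (n - 1) / 2) * n % 8 = 1) ∧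
    ((n % 8 = 3 ∨ n % 8 = 5) → (-1 : ℤ) ^ (n * (n - 1) / 2) * n % 8 = 5) := by
  obtain ⟨p, rfl⟩ := hodd
  have h : (2 * p + 1) * (2 * p + 1 - 1) / 2 = (2 * p + 1) * p := by
    rw [Nat.add_sub_cancel, mul_comm 2 p, ← mul_assoc, Nat.mul_div_cancel _ two_pos]
  rw [h, pow_mul, Odd.neg_one_pow ⟨p, rfl⟩]
  rcases p.even_or_odd with hp | hp
  · rw [hp.neg_one_pow]
    obtain ⟨q, rfl⟩ := hp
    push_cast
    omega
  · rw [hp.neg_one_pow]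
    obtain ⟨q, rfl⟩ := hp
    push_cast
    omega

theorem separable_trinomial {n m : ℕ} (hodd : Odd n) (hm : Odd m) :
    (X ^ n + X ^ m + 1 : (ZMod 2)[X]).Separable := by
  obtain ⟨p, rfl⟩ := hodd
  obtain ⟨q, rfl⟩ := hm
  refine ⟨1, X, ?_⟩
  have h2 : (2 : (ZMod 2)[X]) = 0 := CharTwo.two_eq_zero
  simp only [derivative_add, derivative_X_pow, derivative_one, Nat.add_sub_cancel]
  push_cast
  simp only [map_add, map_mul, map_natCast, C_ofNat, C_1, h2]
  ring_nf
  linear_combination (X ^ (2 * p + 1) + X ^ (2 * q + 1) : (ZMod 2)[X]) * h2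


/-- Let `n` be odd and `m` odd with `0 < m < n/3`. Then `x^n + x^m + 1 ∈ 𝔽₂[x]` is
squarefree; it has an odd number of irreducible factors if `n ≡ ±1 (mod 8)` and an even
number of irreducible factors if `n ≡ ±3 (mod 8)`. -/
theorem trinomial_factor_parity (n m : ℕ) (hodd : Odd n) (hpos : 0 < n)
    (hm : Odd m) (hmpos : 0 < m) (hmn : 3 * m < n)
    (f : Polynomial (ZMod 2)) (hf : f = X ^ n + X ^ m + 1) :
    Squarefree f ∧
    ((n % 8 = 1 ∨ n % 8 = 7) → Odd (UniqueFactorizationMonoid.factors f).card) ∧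
    ((n % 8 = 3 ∨ n % 8 = 5) → Even (UniqueFactorizationMonoid.factors f).card) := by
  have hsep : f.Separable := hf ▸ separable_trinomial hodd hm
  refine ⟨hsep.squarefree, ?_⟩
  set s := UniqueFactorizationMonoid.factors f
  have hf0 : f ≠ 0 := hsep.ne_zero
  have hs : s.prod = f := by
    obtain ⟨u, hu⟩ := UniqueFactorizationMonoid.factors_prod hf0
    obtain ⟨r, hr, hru⟩ := isUnit_iff.mp u.isUnit
    rwa [← hru, isUnit_iff_eq_one.mp hr, C_1, mul_one] at hu
  let K := AlgebraicClosure (ZMod 2)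
  have : CharP K 2 := charP_of_injective_algebraMap (algebraMap (ZMod 2) K).injective 2
  obtain ⟨N, β, σ, hβ, hσ, hsign⟩ := exists_frobenius_perm K s
    fun g hg ↦ UniqueFactorizationMonoid.irreducible_of_factor g hg
  rw [hs] at hβ
  have hinj : Function.Injective β := by
    rw [← separable_prod_X_sub_C_iff, hβ]
    exact hsep.map
  have hβF : ∏ i, (X - C (β i)) = (X ^ n + X ^ m + 1 : ℤ[X]).map (Int.castRingHom K) := by
    simp [hβ, hf]
  obtain rfl : N = n := by
    rw [← natDegree_map_trinomial (R := K) (by omega : m < n), ← hβF]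
    simp
  obtain ⟨d, hd, hd1, hd5⟩ := exists_int_eq_det_vandermonde_sq hβF hinj hσ
  have hmod := det_vandermonde_sq_mod_eight hodd hm hmn (hd ℂ)
  obtain ⟨h1, h3⟩ := neg_one_pow_mul_mod_eight hodd
  constructor
  · intro h
    by_contra hcard
    have := hd5 (by rw [hsign, (hodd.add_even (Nat.not_odd_iff_even.mp hcard)).neg_one_pow])
    have := h1 h
    omega
  · intro h
    by_contra hcard
    have := hd1 (by rw [hsign, (hodd.add_odd (Nat.not_even_iff_odd.mp hcard)).neg_one_pow])
    have := h3 h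
    omega
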